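/- arXiv:1312.1001 — 5 statements merged into one kernel-verified Lean document; each statement's English description precedes it below -/
import Mathlib

section
/- Let V ⊆ ℝ^d be a finite nonempty set, P = conv(V), and P°₀ = {y ∈ ℝ^d : ⟪v,y⟫ ≤ 1 for all v ∈ V}. Let g ∈ ℝ^d define the hyperplane γ = {y : ⟪g,y⟫ = 1}, and suppose γ is tangent to P°₀, i.e. P°₀ ⊆ {y : ⟪g,y⟫ ≤ 1} and there exists a point w ∈ P°₀ with ⟪g,w⟫ = 1. Then the polar point g of γ lies on the boundary of P, i.e. g ∈ P and g ∉ interior(P). -/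
open RealInnerProductSpace

/-- Lemma 6 (0-polar version): if the hyperplane `γ = {y : ⟪g,y⟫ = 1}` is tangent to `P°₀`,
then its polar point `g` lies on the boundary of `P`. -/
theorem tangent_zeroPolar_polar_mem_frontier {d : ℕ} (V : Set (EuclideanSpace ℝ (Fin d)))
    (hVfin : V.Finite) (hVne : V.Nonempty) (g : EuclideanSpace ℝ (Fin d))
    (hsub : {y : EuclideanSpace ℝ (Fin d) | ∀ v ∈ V, ⟪v, y⟫ ≤ 1} ⊆
        {y : EuclideanSpace ℝ (Fin d) | ⟪g, y⟫ ≤ 1})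
    (htan : ∃ w ∈ {y : EuclideanSpace ℝ (Fin d) | ∀ v ∈ V, ⟪v, y⟫ ≤ 1}, ⟪g, w⟫ = 1) :
    g ∈ convexHull ℝ V ∧ g ∉ interior (convexHull ℝ V) := by
  obtain ⟨w, hw, hgw⟩ := htan
  simp only [Set.mem_setOf_eq] at hw
  constructor
  · by_contra hg
    obtain ⟨f, s, hfs, hsg⟩ := geometric_hahn_banach_closed_point (convex_convexHull ℝ V)
      (hVfin.isCompact_convexHull (𝕜 := ℝ)).isClosed hg
    obtain ⟨u, rfl⟩ := (InnerProductSpace.toDual ℝ (EuclideanSpace ℝ (Fin d))).surjective f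
    simp only [InnerProductSpace.toDual_apply_apply] at hfs hsg
    obtain ⟨t, ht, hts⟩ : ∃ t : ℝ, 0 < t ∧ t * s ≤ 1 := by
      refine ⟨1 / (|s| + 1), by positivity, ?_⟩
      rw [one_div, inv_mul_le_iff₀ (by positivity)]
      linarith [le_abs_self s]
    have hy := @hsub ((1 - t * s) • w + t • u) (by
      intro v hv
      have h1 := hfs v (subset_convexHull ℝ V hv)
      rw [inner_add_right, inner_smul_right, inner_smul_right, real_inner_comm u v]
      have h2 := hw v hv
      nlinarith [mul_le_mul_of_nonneg_left h2 (sub_nonneg.2 hts)])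
    simp only [Set.mem_setOf_eq] at hy
    rw [inner_add_right, inner_smul_right, inner_smul_right, real_inner_comm u g, hgw] at hy
    nlinarith
  · intro hg
    have hP : convexHull ℝ V ⊆ {x | ⟪w, x⟫ ≤ 1} := by
      refine convexHull_min (fun v hv => ?_) ?_
      · simpa [real_inner_comm] using hw v hv
      · exact convex_halfSpace_le (innerₗ _ w).isLinear 1
    have hw0 : w ≠ 0 := by
      rintro rfl
      simp at hgw
    have hc : Filter.Tendsto (fun e : ℝ => g + e • w) (nhdsWithin 0 (Set.Ioi 0)) (nhds g) := by
      have : Continuous (fun e : ℝ => g + e • w) := by fun_prop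
      simpa using (this.tendsto 0).mono_left nhdsWithin_le_nhds
    obtain ⟨e, he, he0⟩ := ((hc.eventually (mem_interior_iff_mem_nhds.1 hg)).and
      self_mem_nhdsWithin).exists
    have h := hP he
    simp only [Set.mem_setOf_eq, Set.mem_Ioi] at h he0
    rw [inner_add_right, inner_smul_right, real_inner_comm g w, hgw] at h
    have := mul_pos he0 (real_inner_self_pos.2 hw0)
    linarith
end

section
/- Let V ⊆ ℝ^d be a finite nonempty set, P = conv(V), and P°∞ = {y ∈ ℝ^d : ⟪v,y⟫ ≥ 1 for all v ∈ V}. Let g ∈ ℝ^d define the hyperplane γ = {y : ⟪g,y⟫ = 1}, and suppose γ is tangent to P°∞, i.e. P°∞ ⊆ {y : ⟪g,y⟫ ≥ 1} and there exists a point w ∈ P°∞ with ⟪g,w⟫ = 1. Then the polar point g of γ lies on the boundary of P, i.e. g ∈ P and g ∉ interior(P). -/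
open RealInnerProductSpace

/-- Lemma 6 (∞-polar version): if the hyperplane `γ = {y : ⟪g,y⟫ = 1}` is tangent to `P°∞`,
then its polar point `g` lies on the boundary of `P`. -/
theorem tangent_infPolar_polar_mem_frontier {d : ℕ} (V : Set (EuclideanSpace ℝ (Fin d)))
    (hVfin : V.Finite) (hVne : V.Nonempty) (g : EuclideanSpace ℝ (Fin d))
    (hsub : {y : EuclideanSpace ℝ (Fin d) | ∀ v ∈ V, ⟪v, y⟫ ≥ 1} ⊆
        {y : EuclideanSpace ℝ (Fin d) | ⟪g, y⟫ ≥ 1})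
    (htan : ∃ w ∈ {y : EuclideanSpace ℝ (Fin d) | ∀ v ∈ V, ⟪v, y⟫ ≥ 1}, ⟪g, w⟫ = 1) :
    g ∈ convexHull ℝ V ∧ g ∉ interior (convexHull ℝ V) := by
  obtain ⟨w, hw, hgw⟩ := htan
  have hw' : ∀ v ∈ V, (1:ℝ) ≤ ⟪v, w⟫ := hw
  constructor
  · by_contra hg
    obtain ⟨f, s, hfg, hfV⟩ := geometric_hahn_banach_point_closed (convex_convexHull ℝ V)
      (hVfin.isClosed_convexHull ℝ) hg
    obtain ⟨u, hu⟩ : ∃ u : EuclideanSpace ℝ (Fin d), ∀ x, f x = ⟪x, u⟫ :=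
      ⟨(InnerProductSpace.toDual ℝ _).symm f, fun x => by
        rw [real_inner_comm, InnerProductSpace.toDual_symm_apply]⟩
    obtain ⟨t, ht, hts⟩ : ∃ t : ℝ, 0 < t ∧ t * s ≤ 1 := by
      refine ⟨1 / (1 + |s|), by positivity, ?_⟩
      rw [div_mul_eq_mul_div, div_le_one (by positivity)]
      linarith [le_abs_self s]
    have key : ∀ x : EuclideanSpace ℝ (Fin d),
        ⟪x, (1 - t * s) • w + t • u⟫ = (1 - t * s) * ⟪x, w⟫ + t * ⟪x, u⟫ := fun x => by
      rw [inner_add_right, real_inner_smul_right, real_inner_smul_right]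
    have h1 : (1:ℝ) ≤ ⟪g, (1 - t * s) • w + t • u⟫ := by
      refine hsub (a := (1 - t * s) • w + t • u) ?_
      intro v hv
      have h2 := hfV v (subset_convexHull ℝ V hv)
      rw [hu] at h2
      rw [key, ge_iff_le]
      nlinarith [mul_le_mul_of_nonneg_left (hw' v hv) (sub_nonneg.2 hts),
        mul_le_mul_of_nonneg_left h2.le ht.le]
    rw [key, hgw] at h1
    rw [hu] at hfg
    nlinarith [mul_lt_mul_of_pos_left hfg ht]
  · intro hg
    have hP : convexHull ℝ V ⊆ {x | (1:ℝ) ≤ ⟪x, w⟫} := by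
      refine convexHull_min hw' ?_
      intro x hx y hy a b ha hb hab
      simp only [Set.mem_ofPred_eq] at *
      rw [inner_add_left, real_inner_smul_left, real_inner_smul_left]
      nlinarith [mul_le_mul_of_nonneg_left hx ha, mul_le_mul_of_nonneg_left hy hb]
    have hc : ContinuousAt (fun e : ℝ => g - e • w) 0 := by fun_prop
    have hev := hc.eventually_mem (s := convexHull ℝ V)
      (by simpa using mem_interior_iff_mem_nhds.1 hg)
    obtain ⟨r, hr, hb⟩ := Metric.eventually_nhds_iff.1 hev
    have h3 : (1:ℝ) ≤ ⟪g - (r / 2) • w, w⟫ := hP (hb (y := r / 2) (by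
      rw [Real.dist_eq, sub_zero, abs_of_pos (by positivity)]; linarith))
    rw [inner_sub_left, real_inner_smul_left, hgw] at h3
    have hw0 : w ≠ 0 := by
      rintro rfl
      simp at hgw
    have h4 : (0:ℝ) < ⟪w, w⟫ := real_inner_self_pos.2 hw0
    nlinarith [mul_pos (half_pos hr) h4]
end

section
/- Let V_P, V_Q ⊆ ℝ^d be finite nonempty sets, P = conv(V_P), Q = conv(V_Q), with P°∞ = {y : ⟪v,y⟫ ≥ 1 for all v ∈ V_P} and Q°₀ = {y : ⟪w,y⟫ ≤ 1 for all w ∈ V_Q}. Then P ∩ Q°₀ ≠ ∅ if and only if there exists g ∈ ℝ^d whose polar hyperplane separates P°∞ from Q, i.e. P°∞ ⊆ {y : ⟪g,y⟫ ≥ 1} and Q ⊆ {y : ⟪g,y⟫ ≤ 1}. -/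
open RealInnerProductSpace

/-- Theorem 8 (main polarity theorem): `P` and `Q°₀` intersect iff there is a hyperplane
(the polar hyperplane of some `g`) separating `P°∞` from `Q`. -/
theorem inter_nonempty_iff_separating_hyperplane {d : ℕ}
    (VP VQ : Set (EuclideanSpace ℝ (Fin d)))
    (hVPfin : VP.Finite) (hVPne : VP.Nonempty)
    (hVQfin : VQ.Finite) (hVQne : VQ.Nonempty) :
    (convexHull ℝ VP ∩
        {y : EuclideanSpace ℝ (Fin d) | ∀ w ∈ VQ, ⟪w, y⟫ ≤ 1}).Nonempty ↔
      ∃ g : EuclideanSpace ℝ (Fin d),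
        {y : EuclideanSpace ℝ (Fin d) | ∀ v ∈ VP, ⟪v, y⟫ ≥ 1} ⊆
            {y : EuclideanSpace ℝ (Fin d) | ⟪g, y⟫ ≥ 1} ∧
        convexHull ℝ VQ ⊆ {y : EuclideanSpace ℝ (Fin d) | ⟪g, y⟫ ≤ 1} := by
  constructor
  · rintro ⟨x, hxP, hxQ⟩
    refine ⟨x, ?_, ?_⟩
    · intro y hy
      have hc : Convex ℝ {z : EuclideanSpace ℝ (Fin d) | 1 ≤ ⟪z, y⟫} := by
        intro a ha b hb s t hs ht hst
        simp only [Set.mem_setOf_eq, inner_add_left, real_inner_smul_left] at *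
        nlinarith
      exact convexHull_min (fun v hv => hy v hv) hc hxP
    · apply convexHull_min
      · intro w hw
        have := hxQ w hw
        rw [real_inner_comm] at this
        exact this
      · intro a ha b hb s t hs ht hst
        simp only [Set.mem_setOf_eq, inner_add_right, real_inner_smul_right] at *
        nlinarith
  · rintro ⟨g, hgP, hgQ⟩
    by_contra hne
    have hdisj : Disjoint (segment ℝ 0 g) (convexHull ℝ VP) := by
      rw [Set.disjoint_left]
      rintro p hp hpP
      apply hne
      refine ⟨p, hpP, ?_⟩
      obtain ⟨a, b, ha, hb, hab, rfl⟩ := hp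
      intro w hw
      have h1 : ⟪g, w⟫ ≤ 1 := hgQ (subset_convexHull ℝ VQ hw)
      rw [real_inner_comm] at h1
      simp only [smul_zero, zero_add, real_inner_smul_right]
      nlinarith
    have hcomp : IsCompact (segment ℝ (0 : EuclideanSpace ℝ (Fin d)) g) := by
      rw [← convexHull_pair]
      exact (Set.toFinite {0, g}).isCompact_convexHull ℝ
    obtain ⟨f, u, v, hfu, huv, hfv⟩ := geometric_hahn_banach_compact_closed
      (convex_segment 0 g) hcomp (convex_convexHull ℝ VP)
      (hVPfin.isCompact_convexHull ℝ).isClosed hdisj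
    have hu : 0 < u := by simpa using hfu 0 (left_mem_segment ℝ 0 g)
    have hv : 0 < v := hu.trans huv
    have hg := hfu g (right_mem_segment ℝ 0 g)
    set z := (InnerProductSpace.toDual ℝ (EuclideanSpace ℝ (Fin d))).symm f with hz
    have hfz : ∀ x, ⟪x, z⟫ = f x := fun x => by
      rw [real_inner_comm, hz, InnerProductSpace.toDual_symm_apply]
    have hy : ⟪g, v⁻¹ • z⟫ ≥ 1 := by
      apply hgP
      intro p hp
      have := hfv p (subset_convexHull ℝ VP hp)
      rw [real_inner_smul_right, hfz, ge_iff_le, inv_mul_eq_div, one_le_div hv]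
      exact this.le
    rw [real_inner_smul_right, hfz, ge_iff_le, inv_mul_eq_div, one_le_div hv] at hy
    linarith
end

section
/- Let V_P, V_Q ⊆ ℝ^d be finite nonempty sets, P = conv(V_P), Q = conv(V_Q), with P°∞ = {y : ⟪v,y⟫ ≥ 1 for all v ∈ V_P} and Q°₀ = {y : ⟪w,y⟫ ≤ 1 for all w ∈ V_Q}. Suppose g ∈ ℝ^d is such that its polar hyperplane γ = {y : ⟪g,y⟫ = 1} separates P°∞ from Q (i.e. P°∞ ⊆ {y : ⟪g,y⟫ ≥ 1} and Q ⊆ {y : ⟪g,y⟫ ≤ 1}) and γ is tangent to P°∞ (there exists w ∈ P°∞ with ⟪g,w⟫ = 1). Then g ∈ P ∩ Q°₀. -/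
open RealInnerProductSpace

/-- Theorem 8, claim (2): if the polar hyperplane of `g` separates `P°∞` from `Q` and is
tangent to `P°∞`, then `g ∈ P ∩ Q°₀`. -/
theorem tangent_separating_polar_mem_inter {d : ℕ}
    (VP VQ : Set (EuclideanSpace ℝ (Fin d)))
    (hVPfin : VP.Finite) (hVPne : VP.Nonempty)
    (hVQfin : VQ.Finite) (hVQne : VQ.Nonempty)
    (g : EuclideanSpace ℝ (Fin d))
    (hsepP : {y : EuclideanSpace ℝ (Fin d) | ∀ v ∈ VP, ⟪v, y⟫ ≥ 1} ⊆
        {y : EuclideanSpace ℝ (Fin d) | ⟪g, y⟫ ≥ 1})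
    (hsepQ : convexHull ℝ VQ ⊆ {y : EuclideanSpace ℝ (Fin d) | ⟪g, y⟫ ≤ 1})
    (htan : ∃ w ∈ {y : EuclideanSpace ℝ (Fin d) | ∀ v ∈ VP, ⟪v, y⟫ ≥ 1}, ⟪g, w⟫ = 1) :
    g ∈ convexHull ℝ VP ∩
        {y : EuclideanSpace ℝ (Fin d) | ∀ w ∈ VQ, ⟪w, y⟫ ≤ 1} := by
  refine ⟨?_, fun w hw => ?_⟩
  · by_contra hg
    obtain ⟨f, u, hfg, hfv⟩ := geometric_hahn_banach_point_closed (convex_convexHull ℝ VP)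
      (hVPfin.isCompact_convexHull ℝ).isClosed hg
    obtain ⟨w, hw, hgw⟩ := htan
    obtain ⟨z, rfl⟩ := (InnerProductSpace.toDual ℝ (EuclideanSpace ℝ (Fin d))).surjective f
    simp only [InnerProductSpace.toDual_apply_apply] at hfg hfv
    obtain ⟨t, ht, htu⟩ : ∃ t : ℝ, 0 < t ∧ 0 ≤ 1 - t * u := by
      have h0 : 0 < 1 + |u| := by positivity
      refine ⟨1 / (1 + |u|), by positivity, ?_⟩
      rw [sub_nonneg, one_div_mul_eq_div, div_le_one h0]
      linarith [le_abs_self u]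
    have key := hsepP (a := (1 - t * u) • w + t • z) (by
      intro v hv
      have h1 : 1 ≤ ⟪v, w⟫ := hw v hv
      have h2 := hfv v (subset_convexHull ℝ VP hv)
      rw [real_inner_comm] at h2
      rw [inner_add_right, real_inner_smul_right, real_inner_smul_right]
      nlinarith [mul_le_mul_of_nonneg_left h1 htu, mul_lt_mul_of_pos_left h2 ht])
    rw [Set.mem_ofPred_eq, inner_add_right, real_inner_smul_right, real_inner_smul_right,
      hgw] at key
    rw [real_inner_comm] at hfg
    nlinarith [mul_lt_mul_of_pos_left hfg ht]
  · have h := hsepQ (subset_convexHull ℝ VQ hw)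
    rw [Set.mem_ofPred_eq, real_inner_comm] at h
    exact h
end

section
/- Let V_P, V_Q ⊆ ℝ^d be finite nonempty sets, P = conv(V_P), Q = conv(V_Q), with P°∞ = {y : ⟪v,y⟫ ≥ 1 for all v ∈ V_P} and Q°₀ = {y : ⟪w,y⟫ ≤ 1 for all w ∈ V_Q}. Suppose g ∈ ℝ^d is such that its polar hyperplane γ = {y : ⟪g,y⟫ = 1} separates Q°₀ from P (i.e. Q°₀ ⊆ {y : ⟪g,y⟫ ≤ 1} and P ⊆ {y : ⟪g,y⟫ ≥ 1}) and γ is tangent to Q°₀ (there exists w ∈ Q°₀ with ⟪g,w⟫ = 1). Then g ∈ Q ∩ P°∞. -/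
open RealInnerProductSpace

/-- Theorem 8, symmetric claim (2): if the polar hyperplane of `g` separates `Q°₀` from `P`
and is tangent to `Q°₀`, then `g ∈ Q ∩ P°∞`. -/
theorem tangent_separating_polar_mem_inter_symm {d : ℕ}
    (VP VQ : Set (EuclideanSpace ℝ (Fin d)))
    (hVPfin : VP.Finite) (hVPne : VP.Nonempty)
    (hVQfin : VQ.Finite) (hVQne : VQ.Nonempty)
    (g : EuclideanSpace ℝ (Fin d))
    (hsepQ : {y : EuclideanSpace ℝ (Fin d) | ∀ w ∈ VQ, ⟪w, y⟫ ≤ 1} ⊆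
        {y : EuclideanSpace ℝ (Fin d) | ⟪g, y⟫ ≤ 1})
    (hsepP : convexHull ℝ VP ⊆ {y : EuclideanSpace ℝ (Fin d) | ⟪g, y⟫ ≥ 1})
    (htan : ∃ w ∈ {y : EuclideanSpace ℝ (Fin d) | ∀ v ∈ VQ, ⟪v, y⟫ ≤ 1}, ⟪g, w⟫ = 1) :
    g ∈ convexHull ℝ VQ ∩
        {y : EuclideanSpace ℝ (Fin d) | ∀ v ∈ VP, ⟪v, y⟫ ≥ 1} := by
  refine ⟨?_, fun v hv => ?_⟩
  · by_contra hg
    obtain ⟨w, hw, hgw⟩ := htan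
    obtain ⟨f, u, hf, hfg⟩ := geometric_hahn_banach_closed_point (convex_convexHull ℝ VQ)
      (hVQfin.isCompact_convexHull (𝕜 := ℝ)).isClosed hg
    obtain ⟨a, ha⟩ : ∃ a : EuclideanSpace ℝ (Fin d), ∀ x, f x = ⟪x, a⟫ := by
      refine ⟨(InnerProductSpace.toDual ℝ _).symm f, fun x => ?_⟩
      rw [real_inner_comm, InnerProductSpace.toDual_symm_apply]
    obtain ⟨t, ht, htu⟩ : ∃ t : ℝ, 0 < t ∧ t * u ≤ 1 := by
      refine ⟨1 / (|u| + 1), by positivity, ?_⟩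
      rw [div_mul_eq_mul_div, div_le_one (by positivity)]
      linarith [le_abs_self u]
    have key := hsepQ (a := (1 - t * u) • w + t • a) (by
      intro v hv
      have h1 := hw v hv
      have h2 := hf v (subset_convexHull ℝ VQ hv)
      rw [ha] at h2
      rw [inner_add_right, real_inner_smul_right, real_inner_smul_right]
      nlinarith [mul_le_mul_of_nonneg_left h1 (sub_nonneg.2 htu),
        mul_lt_mul_of_pos_left h2 ht])
    rw [Set.mem_setOf_eq, inner_add_right, real_inner_smul_right, real_inner_smul_right,
      hgw] at key
    rw [ha] at hfg
    nlinarith [mul_lt_mul_of_pos_left hfg ht]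
  · rw [real_inner_comm]
    exact hsepP (subset_convexHull ℝ VP hv)
end
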